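/- Let n ≥ 2 and let A be any n-qubit architecture with R gates. Then the accessible dimension of A is upper-bounded as d_A ≤ 9R + 3n. -/

import Mathlib

open scoped Matrix ENNReal Classical Kronecker ComplexOrder
open MeasureTheory

/-! ## Basic objects: qubit bases, gates, architectures, contraction maps -/

/-- Computational-basis index set for `n` qubits. -/
abbrev QubitBasis (n : ℕ) := Fin n → Fin 2

/-- `2^n × 2^n` complex matrices, indexed by the computational basis of `n` qubits. -/
abbrev NMatrix (n : ℕ) := Matrix (QubitBasis n) (QubitBasis n) ℂ

/-- The special unitary group `SU(4)` of two-qubit gates. -/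
abbrev SU4 := Matrix.specialUnitaryGroup (Fin 4) ℂ

/-- An architecture on `n` qubits with `R` gates: a list of ordered pairs of distinct qubits. -/
def Architecture (n R : ℕ) := Fin R → {p : Fin n × Fin n // p.1 ≠ p.2}

/-- Identification of a pair of one-qubit basis indices with a two-qubit basis index. -/
def pairIdx (a b : Fin 2) : Fin 4 := ⟨2 * a.val + b.val, by omega⟩

/-- The `n`-qubit matrix given by letting the two-qubit matrix `u` act on the
tensor factors `p.1` and `p.2`, and as the identity on all other factors. -/
noncomputable def embedGate {n : ℕ} (p : Fin n × Fin n) (u : Matrix (Fin 4) (Fin 4) ℂ) :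
    NMatrix n := fun a b =>
  if (∀ i, i ≠ p.1 → i ≠ p.2 → a i = b i)
  then u (pairIdx (a p.1) (a p.2)) (pairIdx (b p.1) (b p.2)) else 0

/-- The list of `n`-qubit gates obtained by substituting the gates `x` into
the architecture `A`. -/
noncomputable def gateList {n R : ℕ} (A : Architecture n R) (x : Fin R → SU4) :
    List (NMatrix n) :=
  List.ofFn fun i => embedGate (A i).1 (x i : Matrix (Fin 4) (Fin 4) ℂ)

/-- The contraction map `F^A` of an architecture `A`: it sends a tuple of two-qubit gates
`(u_1, …, u_R)` to the `n`-qubit unitary `(u_R)_{p_R} ⋯ (u_1)_{p_1}`. -/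
noncomputable def contract {n R : ℕ} (A : Architecture n R) (x : Fin R → SU4) : NMatrix n :=
  ((gateList A x).reverse).prod

/-- The exact circuit complexity: the least number `R` of two-qubit gates, arranged in any
architecture, implementing the matrix `U`. -/
noncomputable def Cu (n : ℕ) (U : NMatrix n) : ℕ :=
  sInf {R | ∃ A : Architecture n R, ∃ x : Fin R → SU4, contract A x = U}

/-- The all-zeros computational basis state `|0^n⟩`. -/
noncomputable def ket0 (n : ℕ) : QubitBasis n → ℂ := fun a => if a = fun _ => 0 then 1 else 0

/-- The exact state complexity: the least number `R` of two-qubit gates, arranged in any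
architecture, producing `ψ` from `|0^n⟩`. -/
noncomputable def Cstate (n : ℕ) (ψ : QubitBasis n → ℂ) : ℕ :=
  sInf {R | ∃ A : Architecture n R, ∃ x : Fin R → SU4, (contract A x) *ᵥ ket0 n = ψ}

/-- The gates with indices `lo ≤ i < hi` of `A` form a causal slice with sink qubit `t`:
every qubit `q` is connected to `t` by a path through gates of the slice, taken in
increasing index order. -/
def IsCausalSliceWith {n R : ℕ} (A : Architecture n R) (lo hi : ℕ) (t : Fin n) : Prop :=
  ∀ q : Fin n, ∃ (m : ℕ) (idx : Fin m → Fin R) (qs : Fin (m + 1) → Fin n),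
    StrictMono idx ∧ (∀ l, lo ≤ (idx l : ℕ) ∧ (idx l : ℕ) < hi) ∧
    qs 0 = q ∧ qs (Fin.last m) = t ∧
    ∀ l : Fin m,
      (qs l.castSucc = (A (idx l)).1.1 ∨ qs l.castSucc = (A (idx l)).1.2) ∧
      (qs l.succ = (A (idx l)).1.1 ∨ qs l.succ = (A (idx l)).1.2)

/-- The gates with indices `lo ≤ i < hi` of `A` form a causal slice. -/
def IsCausalSlice {n R : ℕ} (A : Architecture n R) (lo hi : ℕ) : Prop :=
  ∃ t, IsCausalSliceWith A lo hi t

/-! ## Group, topological, measurable and compactness structure on `SU(4)`,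
and its Haar probability measure -/

namespace SU4

theorem star_mem {U : Matrix (Fin 4) (Fin 4) ℂ}
    (hU : U ∈ Matrix.specialUnitaryGroup (Fin 4) ℂ) :
    star U ∈ Matrix.specialUnitaryGroup (Fin 4) ℂ := by
  rw [Matrix.mem_specialUnitaryGroup_iff] at hU ⊢
  refine ⟨Unitary.star_mem hU.1, ?_⟩
  have : (star U).det = star U.det := by
    simp [Matrix.star_eq_conjTranspose, Matrix.det_conjTranspose]
  rw [this, hU.2]
  simp

noncomputable instance : Group SU4 :=
  { (inferInstance : Monoid SU4) with
    inv := fun U => ⟨star U.1, star_mem U.2⟩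
    inv_mul_cancel := fun U => Subtype.ext <| by
      have h := (Matrix.mem_specialUnitaryGroup_iff.mp U.2).1.1
      simpa using h }

instance : IsTopologicalGroup SU4 where
  continuous_mul := by
    apply Continuous.subtype_mk
    exact ((continuous_subtype_val.comp continuous_fst).matrix_mul
      (continuous_subtype_val.comp continuous_snd))
  continuous_inv := by
    apply Continuous.subtype_mk
    exact continuous_star.comp continuous_subtype_val

noncomputable instance : MeasurableSpace (Matrix (Fin 4) (Fin 4) ℂ) :=
  inferInstanceAs (MeasurableSpace (Fin 4 → Fin 4 → ℂ))

instance : BorelSpace (Matrix (Fin 4) (Fin 4) ℂ) :=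
  inferInstanceAs (BorelSpace (Fin 4 → Fin 4 → ℂ))

theorem isClosed :
    IsClosed (Matrix.specialUnitaryGroup (Fin 4) ℂ : Set (Matrix (Fin 4) (Fin 4) ℂ)) := by
  have h1 : IsClosed {M : Matrix (Fin 4) (Fin 4) ℂ | star M * M = 1} :=
    isClosed_eq ((continuous_id.matrix_conjTranspose).matrix_mul continuous_id) continuous_const
  have h2 : IsClosed {M : Matrix (Fin 4) (Fin 4) ℂ | M * star M = 1} :=
    isClosed_eq (continuous_id.matrix_mul (continuous_id.matrix_conjTranspose)) continuous_const
  have h3 : IsClosed {M : Matrix (Fin 4) (Fin 4) ℂ | M.det = 1} :=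
    isClosed_eq continuous_id.matrix_det continuous_const
  have : (Matrix.specialUnitaryGroup (Fin 4) ℂ : Set (Matrix (Fin 4) (Fin 4) ℂ)) =
      ({M | star M * M = 1} ∩ {M | M * star M = 1}) ∩ {M | M.det = 1} := by
    ext M
    simp only [SetLike.mem_coe, Matrix.mem_specialUnitaryGroup_iff, Matrix.unitaryGroup, Unitary.mem_iff,
      Set.mem_inter_iff, Set.mem_setOf_eq]
  rw [this]
  exact ((h1.inter h2)).inter h3

theorem isCompact :
    IsCompact (Matrix.specialUnitaryGroup (Fin 4) ℂ : Set (Matrix (Fin 4) (Fin 4) ℂ)) := by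
  have hK : IsCompact (Set.pi Set.univ fun _ : Fin 4 => Set.pi Set.univ fun _ : Fin 4 =>
      Metric.closedBall (0 : ℂ) 1 : Set (Matrix (Fin 4) (Fin 4) ℂ)) :=
    isCompact_univ_pi fun _ => isCompact_univ_pi fun _ => isCompact_closedBall _ _
  refine IsCompact.of_isClosed_subset hK isClosed ?_
  intro M hM
  refine fun i _ => fun j _ => ?_
  simp only [Metric.mem_closedBall, dist_zero_right]
  exact entry_norm_bound_of_unitary (Matrix.mem_specialUnitaryGroup_iff.mp hM).1 i j

instance : CompactSpace SU4 :=
  isCompact_iff_compactSpace.mp isCompact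

noncomputable instance : MeasurableSpace SU4 := borel SU4

instance : BorelSpace SU4 := ⟨rfl⟩

end SU4

/-- The Haar probability measure on `SU(4)`. -/
noncomputable def haarSU4 : Measure SU4 :=
  Measure.haarMeasure ⟨⟨Set.univ, isCompact_univ⟩, by simp⟩

instance : IsProbabilityMeasure haarSU4 := by
  constructor
  have h : Measure.haarMeasure
      (⟨⟨Set.univ, isCompact_univ⟩, by simp⟩ : TopologicalSpace.PositiveCompacts SU4)
      (⟨⟨Set.univ, isCompact_univ⟩, by simp⟩ : TopologicalSpace.PositiveCompacts SU4) = 1 :=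
    Measure.haarMeasure_self
  simpa [haarSU4] using h

/-- The product of Haar probability measures on `SU(4)^{×R}`: the distribution of a random
quantum circuit with `R` gates in a fixed architecture. -/
noncomputable def muSU4 (R : ℕ) : Measure (Fin R → SU4) :=
  Measure.pi fun _ => haarSU4

/-! ## The differential of the contraction map, its rank, and the accessible dimension -/

/-- The Lie algebra `su(m)` of traceless skew-Hermitian matrices, as a real subspace. -/
noncomputable def suAlgebra (m : Type*) [Fintype m] [DecidableEq m] :
    Submodule ℝ (Matrix m m ℂ) :=
  Submodule.span ℝ {H | Hᴴ = -H ∧ H.trace = 0}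

/-- `embedGate` as a real-linear map in the gate entry. -/
noncomputable def embedLin {n : ℕ} (p : Fin n × Fin n) :
    Matrix (Fin 4) (Fin 4) ℂ →ₗ[ℝ] NMatrix n where
  toFun := embedGate p
  map_add' u v := by
    funext a b
    simp only [embedGate, Matrix.add_apply]
    split <;> simp
  map_smul' r u := by
    funext a b
    simp only [embedGate, Matrix.smul_apply, RingHom.id_apply]
    split <;> simp

/-- The differential of the contraction map `F^A` at the point `x ∈ SU(4)^{×R}`, read in the
exponential charts: the direction `(H_1, …, H_R)` is mapped to
`∑_j (U_R)_{p_R} ⋯ (U_{j+1})_{p_{j+1}} · (H_j)_{p_j} · (U_j)_{p_j} ⋯ (U_1)_{p_1}`. -/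
noncomputable def contractDiff {n R : ℕ} (A : Architecture n R) (x : Fin R → SU4) :
    (Fin R → Matrix (Fin 4) (Fin 4) ℂ) →ₗ[ℝ] NMatrix n :=
  ∑ j : Fin R,
    (LinearMap.mulLeft ℝ (((gateList A x).drop (j + 1)).reverse.prod)) ∘ₗ
      (LinearMap.mulRight ℝ
        (embedGate (A j).1 (x j : Matrix (Fin 4) (Fin 4) ℂ) *
          ((gateList A x).take j).reverse.prod)) ∘ₗ
      (embedLin (A j).1) ∘ₗ
      (LinearMap.proj j)

/-- The rank of (the differential of) the contraction map `F^A` at `x`: the dimension of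
the image, under the differential, of the tangent space `su(4)^{×R}`. -/
noncomputable def rankAt {n R : ℕ} (A : Architecture n R) (x : Fin R → SU4) : ℕ :=
  Module.finrank ℝ
    ↥(Submodule.map (contractDiff A x) (Submodule.pi Set.univ fun _ => suAlgebra (Fin 4)))

/-- The maximal rank `r_max` of the contraction map `F^A` over all points of `SU(4)^{×R}`. -/
noncomputable def rmax {n R : ℕ} (A : Architecture n R) : ℕ := ⨆ x, rankAt A x

/-- A matrix viewed as a point of the Euclidean (Frobenius) space of its entries. -/
noncomputable def toEuc {n : ℕ} (M : NMatrix n) :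
    EuclideanSpace ℂ (QubitBasis n × QubitBasis n) := WithLp.toLp 2 fun p => M p.1 p.2

/-- The Frobenius norm `‖X‖_F = (tr (X† X))^{1/2}` of an `n`-qubit matrix. -/
noncomputable def frobNorm {n : ℕ} (M : NMatrix n) : ℝ := ‖toEuc M‖

/-- The accessible dimension `d_A` of an architecture `A`: the Hausdorff dimension of the
set `U(A)` of unitaries implementable with `A`, with respect to the Frobenius metric. -/
noncomputable def accessibleDim {n R : ℕ} (A : Architecture n R) : ℝ≥0∞ :=
  dimH (toEuc '' Set.range (contract A))

/-! ## Pauli strings and Clifford gates -/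

/-- The Pauli matrices `1, X, Y, Z`. -/
noncomputable def pauli : Fin 4 → Matrix (Fin 2) (Fin 2) ℂ
  | 0 => 1
  | 1 => !![0, 1; 1, 0]
  | 2 => !![0, -Complex.I; Complex.I, 0]
  | 3 => !![1, 0; 0, -1]

/-- The `n`-qubit Pauli string `⨂ᵢ pauli (s i)`. -/
noncomputable def pauliString {n : ℕ} (s : Fin n → Fin 4) : NMatrix n :=
  fun a b => ∏ i, pauli (s i) (a i) (b i)

/-- A two-qubit Pauli string, as a `4 × 4` matrix. -/
noncomputable def pauli2 (s : Fin 2 → Fin 4) : Matrix (Fin 4) (Fin 4) ℂ :=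
  fun a b =>
    pauli (s 0) ⟨a.val / 2, by have := a.isLt; omega⟩ ⟨b.val / 2, by have := b.isLt; omega⟩ *
    pauli (s 1) ⟨a.val % 2, by have := a.isLt; omega⟩ ⟨b.val % 2, by have := b.isLt; omega⟩

/-- A two-qubit gate is Clifford if it maps every Pauli string to a scalar multiple of a
Pauli string under conjugation. -/
def IsCliffordGate (u : Matrix (Fin 4) (Fin 4) ℂ) : Prop :=
  ∀ s : Fin 2 → Fin 4, ∃ (c : ℂ) (s' : Fin 2 → Fin 4),
    u * pauli2 s * uᴴ = c • pauli2 s'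

/-- Application to the state `|0^n⟩`, `M ↦ M |0^n⟩`, as a real-linear map. -/
noncomputable def mulVecKet0 (n : ℕ) : NMatrix n →ₗ[ℝ] (QubitBasis n → ℂ) where
  toFun M := M *ᵥ ket0 n
  map_add' M N := Matrix.add_mulVec M N (ket0 n)
  map_smul' r M := by
    simp only [RingHom.id_apply]
    exact Matrix.smul_mulVec r M (ket0 n)

/-- The rank of (the differential of) the map `G^A : x ↦ F^A(x)|0^n⟩` at `x`. -/
noncomputable def stateRankAt {n R : ℕ} (A : Architecture n R) (x : Fin R → SU4) : ℕ :=
  Module.finrank ℝ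
    ↥(Submodule.map ((mulVecKet0 n) ∘ₗ contractDiff A x)
      (Submodule.pi Set.univ fun _ => suAlgebra (Fin 4)))

/-! ## Trace norm and operator norm -/

/-- The positive semidefinite square root of a positive semidefinite matrix. -/
noncomputable def Matrix.PosSemidef.sqrt {m 𝕜 : Type*} [Fintype m] [RCLike 𝕜] [DecidableEq m]
    {A : Matrix m m 𝕜} (hA : A.PosSemidef) : Matrix m m 𝕜 :=
  hA.1.eigenvectorUnitary.1 * Matrix.diagonal ((↑) ∘ Real.sqrt ∘ hA.1.eigenvalues) *
    (star hA.1.eigenvectorUnitary : Matrix m m 𝕜)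

/-- The trace norm `‖M‖₁ = tr ((M† M)^{1/2})` of a square complex matrix. -/
noncomputable def traceNorm {m : Type*} [Fintype m] [DecidableEq m] (M : Matrix m m ℂ) : ℝ :=
  ((Matrix.posSemidef_conjTranspose_mul_self M).sqrt.trace).re

/-- The operator norm (largest singular value) of a square complex matrix: the norm of the
induced operator between Euclidean spaces. -/
noncomputable def opNorm {m : Type*} [Fintype m] [DecidableEq m] (M : Matrix m m ℂ) : ℝ :=
  ‖LinearMap.toContinuousLinearMap (Matrix.toEuclideanLin M)‖

/-! ## The uniform measure on a finite index set -/

/-- The uniform probability measure on `Fin m`. -/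
noncomputable def uniformFin (m : ℕ) : Measure (Fin m) :=
  ((m : ℝ≥0∞))⁻¹ • Measure.count

instance (m : ℕ) : IsFiniteMeasure (uniformFin m) := by
  constructor
  rw [uniformFin, Measure.smul_apply, smul_eq_mul, Measure.count_univ,
    ENat.card_eq_coe_fintype_card, Fintype.card_fin, ENat.toENNReal_coe]
  rcases Nat.eq_zero_or_pos m with h | h
  · simp [h]
  · rw [ENNReal.inv_mul_cancel (by exact_mod_cast h.ne') (by simp)]
    exact ENNReal.one_lt_top


abbrev M22 := Matrix (Fin 2 × Fin 2) (Fin 2 × Fin 2) ℂ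
abbrev M2 := Matrix (Fin 2) (Fin 2) ℂ

/-- embedding with product indices -/
noncomputable def embP {n : ℕ} (p : Fin n × Fin n) (u : M22) : NMatrix n := fun a b =>
  if (∀ i, i ≠ p.1 → i ≠ p.2 → a i = b i) then u (a p.1, a p.2) (b p.1, b p.2) else 0

/-- local unitary -/
noncomputable def locT {n : ℕ} (g : Fin n → M2) : NMatrix n := fun a b => ∏ i, g i (a i) (b i)

theorem pairIdx_bij : Function.Bijective (fun q : Fin 2 × Fin 2 => pairIdx q.1 q.2) := by
  decide

noncomputable def pairE : Fin 2 × Fin 2 ≃ Fin 4 := Equiv.ofBijective _ pairIdx_bij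

theorem embedGate_eq {n : ℕ} (p : Fin n × Fin n) (u : Matrix (Fin 4) (Fin 4) ℂ) :
    embedGate p u = embP p (u.submatrix pairE pairE) := by
  funext a b
  simp [embedGate, embP, pairE]

/-- unitary of determinant one -/
def IsSU {m : Type} [Fintype m] [DecidableEq m] (u : Matrix m m ℂ) : Prop :=
  u * uᴴ = 1 ∧ u.det = 1

theorem IsSU.left {m : Type} [Fintype m] [DecidableEq m] {u : Matrix m m ℂ} (h : IsSU u) :
    uᴴ * u = 1 := mul_eq_one_comm.mp h.1

theorem IsSU.mul {m : Type} [Fintype m] [DecidableEq m] {u v : Matrix m m ℂ} (h : IsSU u)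
    (k : IsSU v) : IsSU (u * v) := by
  refine ⟨?_, by rw [Matrix.det_mul, h.2, k.2, one_mul]⟩
  rw [Matrix.conjTranspose_mul, Matrix.mul_assoc, ← Matrix.mul_assoc v, k.1, Matrix.one_mul, h.1]

theorem IsSU.star {m : Type} [Fintype m] [DecidableEq m] {u : Matrix m m ℂ} (h : IsSU u) :
    IsSU uᴴ := by
  refine ⟨?_, by rw [Matrix.det_conjTranspose, h.2, star_one]⟩
  rw [Matrix.conjTranspose_conjTranspose, h.left]

theorem IsSU.one {m : Type} [Fintype m] [DecidableEq m] : IsSU (1 : Matrix m m ℂ) := by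
  simp [IsSU]

theorem IsSU.kron {u v : M2} (h : IsSU u) (k : IsSU v) : IsSU (u ⊗ₖ v) := by
  refine ⟨?_, by rw [Matrix.det_kronecker, h.2, k.2]; simp⟩
  rw [Matrix.conjTranspose_kronecker, ← Matrix.mul_kronecker_mul, h.1, k.1,
    Matrix.one_kronecker_one]

theorem IsSU.of_SU4 (u : SU4) : IsSU ((u : Matrix (Fin 4) (Fin 4) ℂ).submatrix pairE pairE) := by
  have h := Matrix.mem_specialUnitaryGroup_iff.mp u.2
  refine ⟨?_, by rw [Matrix.det_submatrix_equiv_self]; exact h.2⟩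
  rw [Matrix.conjTranspose_submatrix, Matrix.submatrix_mul_equiv]
  have h1 := h.1.2
  rw [Matrix.star_eq_conjTranspose] at h1
  rw [h1, Matrix.submatrix_one_equiv]

theorem sum_agree {n : ℕ} (p : Fin n × Fin n) (hp : p.1 ≠ p.2) (c : QubitBasis n)
    (F : QubitBasis n → ℂ) :
    (∑ b, if (∀ i, i ≠ p.1 → i ≠ p.2 → b i = c i) then F b else 0) =
      ∑ q : Fin 2 × Fin 2, F (Function.update (Function.update c p.1 q.1) p.2 q.2) := by
  rw [← Finset.sum_filter]
  refine Finset.sum_nbij' (fun b => (b p.1, b p.2))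
    (fun q => Function.update (Function.update c p.1 q.1) p.2 q.2) ?_ ?_ ?_ ?_ ?_
  · simp
  · intro q _
    simp only [Finset.mem_filter, Finset.mem_univ, true_and]
    intro i h1 h2
    simp [h1, h2]
  · intro b hb
    simp only [Finset.mem_filter, Finset.mem_univ, true_and] at hb
    funext i
    by_cases h2 : i = p.2
    · subst h2; simp
    by_cases h1 : i = p.1
    · subst h1; simp [hp]
    simp [h1, h2, hb i h1 h2]
  · intro q _
    simp [hp]
  · intro b hb
    simp only [Finset.mem_filter, Finset.mem_univ, true_and] at hb
    congr 1
    funext i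
    by_cases h2 : i = p.2
    · subst h2; simp
    by_cases h1 : i = p.1
    · subst h1; simp [hp]
    simp [h1, h2, hb i h1 h2]

theorem prod_split {n : ℕ} (p : Fin n × Fin n) (hp : p.1 ≠ p.2) (f : Fin n → ℂ) :
    ∏ i, f i = f p.1 * f p.2 * ∏ i ∈ (Finset.univ.erase p.1).erase p.2, f i := by
  rw [mul_assoc, Finset.mul_prod_erase _ _ (by simp [hp.symm]), Finset.mul_prod_erase _ _ (by simp)]

theorem loc_emb {n : ℕ} (p : Fin n × Fin n) (hp : p.1 ≠ p.2) (g g' : Fin n → M2) (w v : M22)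
    (hg : ∀ i, i ≠ p.1 → i ≠ p.2 → g i = g' i)
    (h : (g p.1 ⊗ₖ g p.2) * w = v * (g' p.1 ⊗ₖ g' p.2)) :
    locT g * embP p w = embP p v * locT g' := by
  funext a c
  have h2 := congrFun (congrFun h (a p.1, a p.2)) (c p.1, c p.2)
  rw [Matrix.mul_apply, Matrix.mul_apply] at h2 ⊢
  simp only [Matrix.kroneckerMap_apply] at h2
  have e1 : ∀ b, locT g a b * embP p w b c =
      if (∀ i, i ≠ p.1 → i ≠ p.2 → b i = c i) then
        locT g a b * w (b p.1, b p.2) (c p.1, c p.2) else 0 := by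
    intro b; simp only [embP]; split <;> simp
  have e2 : ∀ b, embP p v a b * locT g' b c =
      if (∀ i, i ≠ p.1 → i ≠ p.2 → b i = a i) then
        v (a p.1, a p.2) (b p.1, b p.2) * locT g' b c else 0 := by
    intro b; simp only [embP]
    simp only [eq_comm (a := b _)]
    split <;> simp
  simp only [e1, e2]
  rw [sum_agree p hp, sum_agree p hp]
  have key : ∀ (q : Fin 2 × Fin 2) (x : QubitBasis n),
      ∏ i ∈ (Finset.univ.erase p.1).erase p.2, g i (a i)
        (Function.update (Function.update c p.1 q.1) p.2 q.2 i) =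
      ∏ i ∈ (Finset.univ.erase p.1).erase p.2, g i (a i) (c i) := by
    intro q x
    refine Finset.prod_congr rfl fun i hi => ?_
    simp only [Finset.mem_erase, Finset.mem_univ, and_true] at hi
    simp [hi.1, hi.2]
  have key' : ∀ (q : Fin 2 × Fin 2),
      ∏ i ∈ (Finset.univ.erase p.1).erase p.2, g' i
        (Function.update (Function.update a p.1 q.1) p.2 q.2 i) (c i) =
      ∏ i ∈ (Finset.univ.erase p.1).erase p.2, g i (a i) (c i) := by
    intro q
    refine Finset.prod_congr rfl fun i hi => ?_
    simp only [Finset.mem_erase, Finset.mem_univ, and_true] at hi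
    rw [hg i hi.2 hi.1]
    simp [hi.1, hi.2]
  simp only [locT]
  simp only [prod_split p hp, key _ a, key']
  simp only [Function.update_self, Function.update_of_ne hp]
  rw [← Finset.sum_congr rfl fun q _ => (mul_right_comm _ _ _), ← Finset.sum_mul,
    ← Finset.sum_congr rfl fun q _ => (mul_assoc _ _ _), ← Finset.sum_mul, h2]

theorem locT_one {n : ℕ} : locT (fun _ : Fin n => (1 : M2)) = 1 := by
  funext a b
  simp only [locT, Matrix.one_apply]
  by_cases h : a = b
  · subst h; simp
  · rw [if_neg h]
    obtain ⟨i, hi⟩ := Function.ne_iff.mp h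
    exact Finset.prod_eq_zero (Finset.mem_univ i) (by simp [hi])

/-- SU(2) parametrization -/
noncomputable def su2P (t : Fin 3 → ℝ) : M2 :=
  !![Complex.cos (t 0) * Complex.exp (t 1 * Complex.I),
      - (Complex.sin (t 0) * Complex.exp (-(t 2 * Complex.I)));
    Complex.sin (t 0) * Complex.exp (t 2 * Complex.I),
      Complex.cos (t 0) * Complex.exp (-(t 1 * Complex.I))]

theorem su2P_contDiff (i j : Fin 2) : ContDiff ℝ 1 (fun t => su2P t i j) := by
  have h : ∀ k : Fin 3, ContDiff ℝ 1 (fun t : Fin 3 → ℝ => ((t k : ℝ) : ℂ)) := fun k =>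
    Complex.ofRealCLM.contDiff.comp (contDiff_apply ℝ ℝ k)
  have hc : ContDiff ℝ 1 (fun t : Fin 3 → ℝ => Complex.cos (t 0)) := (Complex.contDiff_cos.restrict_scalars ℝ).comp (h 0)
  have hs : ContDiff ℝ 1 (fun t : Fin 3 → ℝ => Complex.sin (t 0)) := (Complex.contDiff_sin.restrict_scalars ℝ).comp (h 0)
  have e1 := ((h 1).mul (contDiff_const (c := Complex.I))).cexp
  have e2 := ((h 2).mul (contDiff_const (c := Complex.I))).cexp
  have e1' := ((h 1).mul (contDiff_const (c := Complex.I))).neg.cexp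
  have e2' := ((h 2).mul (contDiff_const (c := Complex.I))).neg.cexp
  fin_cases i <;> fin_cases j <;> simp [su2P]
  · exact hc.mul e1
  · exact (hs.mul e2').neg
  · exact hs.mul e2
  · exact hc.mul e1'

theorem su2P_surj {u : M2} (h : IsSU u) : ∃ t, u = su2P t := by
  have h1 := h.left
  have hd := h.2
  -- star u is the adjugate
  have hadj : uᴴ = u.adjugate := by
    have := Matrix.mul_adjugate u
    rw [hd, one_smul] at this
    calc uᴴ = uᴴ * (u * u.adjugate) := by rw [this, Matrix.mul_one]
      _ = u.adjugate := by rw [← Matrix.mul_assoc, h1, Matrix.one_mul]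
  rw [Matrix.adjugate_fin_two] at hadj
  have a1 := congrFun (congrFun hadj 0) 0
  have a2 := congrFun (congrFun hadj 0) 1
  simp at a1 a2
  rw [Matrix.det_fin_two] at hd
  have hn : ‖u 0 0‖ ^ 2 + ‖u 1 0‖ ^ 2 = 1 := by
    have : ((‖u 0 0‖ ^ 2 + ‖u 1 0‖ ^ 2 : ℝ) : ℂ) = 1 := by
      push_cast
      rw [← Complex.mul_conj', ← Complex.mul_conj', a1, a2, ← hd]
      ring
    exact_mod_cast this
  have hcos : Real.cos (Real.arccos ‖u 0 0‖) = ‖u 0 0‖ :=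
    Real.cos_arccos (by linarith [norm_nonneg (u 0 0)]) (by nlinarith [norm_nonneg (u 0 0)])
  have hsin : Real.sin (Real.arccos ‖u 0 0‖) = ‖u 1 0‖ := by
    rw [Real.sin_arccos, show 1 - ‖u 0 0‖ ^ 2 = ‖u 1 0‖ ^ 2 by linarith,
      Real.sqrt_sq (norm_nonneg _)]
  have e0 := Complex.norm_mul_exp_arg_mul_I (u 0 0)
  have e1 := Complex.norm_mul_exp_arg_mul_I (u 1 0)
  have c0 := congrArg (starRingEnd ℂ) e0
  have c1 := congrArg (starRingEnd ℂ) e1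
  simp only [map_mul, ← Complex.exp_conj, Complex.conj_ofReal, Complex.conj_I, mul_neg] at c0 c1
  have hcos' : Complex.cos (Real.arccos ‖u 0 0‖) = ‖u 0 0‖ := by exact_mod_cast hcos
  have hsin' : Complex.sin (Real.arccos ‖u 0 0‖) = ‖u 1 0‖ := by exact_mod_cast hsin
  refine ⟨![Real.arccos ‖u 0 0‖, (u 0 0).arg, (u 1 0).arg], ?_⟩
  ext i j
  fin_cases i <;> fin_cases j <;> simp [su2P] <;> simp only [hcos', hsin', e0, e1, c0, c1]
  · rw [a2, neg_neg]
  · exact a1.symm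


theorem pauli_herm (a : Fin 4) : (pauli a)ᴴ = pauli a := by
  fin_cases a <;> ext i j <;> fin_cases i <;> fin_cases j <;> simp [pauli]

theorem pauli_trace (a : Fin 3) : (pauli a.succ).trace = 0 := by
  fin_cases a <;> simp [pauli, Matrix.trace_fin_two]

theorem det_exp_skew {m : Type} [Fintype m] [DecidableEq m] {X : Matrix m m ℂ} (h : Xᴴ = -X) :
    (NormedSpace.exp X).det = Complex.exp X.trace := by
  have hH : ((-Complex.I) • X).IsHermitian := by
    rw [Matrix.IsHermitian, Matrix.conjTranspose_smul, h]
    simp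
  have hX : X = (hH.eigenvectorUnitary : Matrix m m ℂ) *
      Matrix.diagonal (fun i => Complex.I * (hH.eigenvalues i : ℂ)) *
      (hH.eigenvectorUnitary : Matrix m m ℂ)⁻¹ := by
    have h1 := hH.spectral_theorem
    have h3 : X = Complex.I • (-Complex.I • X) := by
      rw [smul_smul]; simp
    have hinv : (hH.eigenvectorUnitary : Matrix m m ℂ)⁻¹ =
        star (hH.eigenvectorUnitary : Matrix m m ℂ) :=
      Matrix.inv_eq_right_inv (Unitary.coe_mul_star_self _)
    have h4 := h3.trans (congrArg (fun Y => Complex.I • Y) h1)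
    refine h4.trans ?_
    rw [Unitary.conjStarAlgAut_apply, hinv, ← Matrix.smul_mul, ← Matrix.mul_smul,
      ← Matrix.diagonal_smul]
    rfl
  have hU : IsUnit (hH.eigenvectorUnitary : Matrix m m ℂ) :=
    IsUnit.of_mul_eq_one _ (Unitary.coe_mul_star_self _)
  generalize (hH.eigenvectorUnitary : Matrix m m ℂ) = U at hX hU
  rw [hX, Matrix.exp_conj _ _ hU, Matrix.exp_diagonal, Matrix.det_conj hU,
    Matrix.trace_mul_comm, ← Matrix.mul_assoc, Matrix.nonsing_inv_mul _ ((Matrix.isUnit_iff_isUnit_det _).mp hU), Matrix.one_mul,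
    Matrix.det_diagonal, Matrix.trace_diagonal, Complex.exp_sum]
  refine Finset.prod_congr rfl fun i _ => ?_
  rw [Complex.exp_eq_exp_ℂ, Pi.coe_exp]

theorem isSU_exp {m : Type} [Fintype m] [DecidableEq m] {X : Matrix m m ℂ} (h : Xᴴ = -X)
    (ht : X.trace = 0) : IsSU (NormedSpace.exp X) := by
  refine ⟨?_, by rw [det_exp_skew h, ht, Complex.exp_zero]⟩
  rw [← Matrix.exp_conjTranspose, h, Matrix.exp_neg]
  exact Matrix.mul_nonsing_inv _ ((Matrix.isUnit_iff_isUnit_det _).mp (Matrix.isUnit_exp X))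

noncomputable def pA (c : Fin 4 → Fin 4 → ℂ) : M2 :=
  ∑ a : Fin 3, (Complex.I * (c a.succ 0).im) • pauli a.succ
noncomputable def pB (c : Fin 4 → Fin 4 → ℂ) : M2 :=
  ∑ a : Fin 3, (Complex.I * (c 0 a.succ).im) • pauli a.succ
noncomputable def pL (c : Fin 4 → Fin 4 → ℂ) : M22 :=
  ∑ a, ∑ b, c a b • (pauli a ⊗ₖ pauli b)
noncomputable def pT (t : Fin 3 → Fin 3 → ℝ) : M22 :=
  ∑ a : Fin 3, ∑ b : Fin 3, (Complex.I * t a b) • (pauli a.succ ⊗ₖ pauli b.succ)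
noncomputable def pM (c : Fin 4 → Fin 4 → ℂ) : M22 :=
  pL c - pA c ⊗ₖ (1 : M2) - (1 : M2) ⊗ₖ pB c

theorem pA_skew (c) : (pA c)ᴴ = - pA c := by
  simp [pA, Matrix.conjTranspose_sum, Matrix.conjTranspose_smul, pauli_herm]
theorem pB_skew (c) : (pB c)ᴴ = - pB c := by
  simp [pB, Matrix.conjTranspose_sum, Matrix.conjTranspose_smul, pauli_herm]
theorem pA_trace (c) : (pA c).trace = 0 := by
  simp [pA, Matrix.trace_sum, Matrix.trace_smul, pauli_trace]
theorem pB_trace (c) : (pB c).trace = 0 := by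
  simp [pB, Matrix.trace_sum, Matrix.trace_smul, pauli_trace]

theorem pauli_complete (i j k l : Fin 2) :
    ∑ a, pauli a i j * pauli a k l = if i = l ∧ j = k then 2 else 0 := by
  fin_cases i <;> fin_cases j <;> fin_cases k <;> fin_cases l <;>
    simp [Fin.sum_univ_four, pauli] <;> norm_num

theorem pauli_unit (k l : Fin 2) :
    ∑ a, (pauli a l k / 2) • pauli a = Matrix.single k l (1 : ℂ) := by
  ext i j
  have := pauli_complete i j l k
  simp only [Matrix.sum_apply, Matrix.smul_apply, smul_eq_mul]
  calc _ = (∑ a, pauli a i j * pauli a l k) / 2 := by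
        rw [Finset.sum_div]; exact Finset.sum_congr rfl fun a _ => by ring
    _ = _ := by
      rw [this, Matrix.single_apply]
      by_cases h1 : k = i <;> by_cases h2 : l = j <;> simp [h1, h2, eq_comm] 
      

theorem pL_add (c d) : pL (c + d) = pL c + pL d := by
  simp [pL, add_smul, Finset.sum_add_distrib]
theorem pL_smul (r : ℂ) (c) : pL (r • c) = r • pL c := by
  simp [pL, Finset.smul_sum, mul_smul]

theorem pL_surj (x : M22) : ∃ c, pL c = x := by
  let Lm : (Fin 4 → Fin 4 → ℂ) →ₗ[ℂ] M22 :=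
    { toFun := pL, map_add' := pL_add, map_smul' := pL_smul }
  suffices h : x ∈ LinearMap.range Lm from h
  rw [Matrix.matrix_eq_sum_single x]
  refine Submodule.sum_mem _ fun q _ => Submodule.sum_mem _ fun r _ => ?_
  have : Matrix.single q r (x q r) = x q r • Matrix.single q r (1 : ℂ) := by
    rw [Matrix.smul_single, smul_eq_mul, mul_one]
  rw [this]
  refine Submodule.smul_mem _ _ ?_
  have hmem : ∀ c, pL c ∈ LinearMap.range Lm := fun c => ⟨c, rfl⟩
  suffices hs : Matrix.single q r (1 : ℂ) =
      pL (fun a b => (pauli a r.1 q.1 / 2) * (pauli b r.2 q.2 / 2)) by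
    rw [hs]; exact hmem _
  symm
  have h1 := pauli_unit q.1 r.1
  have h2 := pauli_unit q.2 r.2
  rw [pL]
  have h3 : Matrix.single q r (1 : ℂ) = Matrix.single q.1 r.1 (1 : ℂ) ⊗ₖ Matrix.single q.2 r.2 (1 : ℂ) := by
    rw [Matrix.single_kronecker_single]; simp
  rw [h3, ← h1, ← h2]
  ext ⟨i, i'⟩ ⟨j, j'⟩
  simp only [Matrix.sum_apply, Matrix.smul_apply, Matrix.kroneckerMap_apply, smul_eq_mul,
    Finset.sum_mul_sum]
  exact Finset.sum_congr rfl fun a _ => Finset.sum_congr rfl fun b _ => by ring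

theorem pM_form (c) (h : (pM c)ᴴ = - pM c) (ht : (pM c).trace = 0) : ∃ t, pM c = pT t := by
  have hz : pauli 0 = 1 := rfl
  have im2 : ∀ z : ℂ, z - (starRingEnd ℂ) z = 2 * (Complex.I * z.im) := by
    intro z; apply Complex.ext <;> simp; ring
  have hL : (pL c)ᴴ = pL (fun a b => (starRingEnd ℂ) (c a b)) := by
    simp [pL, Matrix.conjTranspose_sum, Matrix.conjTranspose_smul, Matrix.conjTranspose_kronecker,
      pauli_herm]
  have key : (2 : ℂ) • pM c = (2 : ℂ) • ((Complex.I * (c 0 0).im) • (1 : M22) + pT (fun a b => (c a.succ b.succ).im)) := by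
    have e : (2 : ℂ) • pM c = pM c - (pM c)ᴴ := by rw [h]; module
    have e2 : (pM c)ᴴ = pL (fun a b => (starRingEnd ℂ) (c a b)) + pA c ⊗ₖ (1 : M2) + (1 : M2) ⊗ₖ pB c := by
      conv_lhs => rw [pM]
      rw [Matrix.conjTranspose_sub, Matrix.conjTranspose_sub, hL, Matrix.conjTranspose_kronecker,
        Matrix.conjTranspose_kronecker, pA_skew, pB_skew]
      ext ⟨i, i'⟩ ⟨j, j'⟩
      simp [Matrix.kroneckerMap_apply]
    have e3 : pL c - pL (fun a b => (starRingEnd ℂ) (c a b)) = pL (fun a b => 2 * (Complex.I * (c a b).im)) := by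
      simp only [pL, ← Finset.sum_sub_distrib, ← sub_smul, im2]
    have e4 : (2 : ℂ) • pM c = pL (fun a b => 2 * (Complex.I * (c a b).im)) - (2 : ℂ) • (pA c ⊗ₖ (1 : M2)) - (2 : ℂ) • ((1 : M2) ⊗ₖ pB c) := by
      rw [e, e2, ← e3, pM]; module
    rw [e4]
    ext ⟨i, i'⟩ ⟨j, j'⟩
    simp only [pL, pA, pB, pT, Fin.sum_univ_succ, Matrix.add_apply, Matrix.sub_apply, Matrix.smul_apply, Matrix.kroneckerMap_apply, hz, smul_eq_mul, ← Matrix.one_kronecker_one (α := ℂ) (m := Fin 2) (n := Fin 2), Fin.succ_zero_eq_one, Finset.univ_unique, Finset.sum_singleton]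
    ring
  have key2 := smul_right_injective M22 (two_ne_zero (α := ℂ)) key
  have htT : (pT (fun a b => (c a.succ b.succ).im)).trace = 0 := by
    simp [pT, Matrix.trace_sum, Matrix.trace_smul, Matrix.trace_kronecker, pauli_trace]
  refine ⟨fun a b => (c a.succ b.succ).im, key2.trans ?_⟩
  rw [key2, Matrix.trace_add, htT, Matrix.trace_smul, Matrix.trace_one] at ht
  simp at ht
  simp [ht]


section Slice
open scoped Matrix.Norms.Operator Topology

theorem exp_entry_contDiff (i j : Fin 2 × Fin 2) :
    ContDiff ℝ 1 (fun t : Fin 3 → Fin 3 → ℝ => NormedSpace.exp (pT t) i j) := by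
  have h1 : ContDiff ℝ 1 (NormedSpace.exp : M22 → M22) := by
    rw [contDiff_iff_contDiffAt]
    intro x
    exact (NormedSpace.exp_analytic (𝕂 := ℝ) x).contDiffAt
  have h2 : ContDiff ℝ 1 pT := by
    let l : (Fin 3 → Fin 3 → ℝ) →ₗ[ℝ] M22 :=
      { toFun := pT
        map_add' := fun s t => by simp [pT, mul_add, add_smul, Finset.sum_add_distrib]
        map_smul' := fun r t => by
          simp only [pT, Finset.smul_sum, RingHom.id_apply, ← Complex.coe_smul, smul_smul]
          simp [mul_left_comm] }
    exact (LinearMap.toContinuousLinearMap l).contDiff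
  let e : M22 →ₗ[ℝ] ℂ :=
    { toFun := fun M => M i j
      map_add' := fun _ _ => rfl
      map_smul' := fun _ _ => rfl }
  exact (LinearMap.toContinuousLinearMap e).contDiff.comp (h1.comp h2)

theorem slice_nhds : ∃ N ∈ 𝓝 (1 : M22), ∀ u ∈ N, IsSU u → ∃ (t : Fin 3 → Fin 3 → ℝ) (a b : M2),
    IsSU a ∧ IsSU b ∧ u = NormedSpace.exp (pT t) * (a ⊗ₖ b) := by
  let k1 : M2 →ₗ[ℝ] M22 :=
    { toFun := fun a => a ⊗ₖ (1 : M2)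
      map_add' := fun x y => Matrix.add_kronecker _ _ _
      map_smul' := fun r x => Matrix.smul_kronecker _ _ _ }
  let k2 : M2 →ₗ[ℝ] M22 :=
    { toFun := fun a => (1 : M2) ⊗ₖ a
      map_add' := fun x y => Matrix.kronecker_add _ _ _
      map_smul' := fun r x => Matrix.kronecker_smul _ _ _ }
  let lA : (Fin 4 → Fin 4 → ℂ) →ₗ[ℝ] M2 :=
    { toFun := pA
      map_add' := fun s t => by simp [pA, mul_add, add_smul, Finset.sum_add_distrib]
      map_smul' := fun r t => by
        simp only [pA, Finset.smul_sum, RingHom.id_apply, ← Complex.coe_smul, smul_smul]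
        simp [mul_left_comm] }
  let lB : (Fin 4 → Fin 4 → ℂ) →ₗ[ℝ] M2 :=
    { toFun := pB
      map_add' := fun s t => by simp [pB, mul_add, add_smul, Finset.sum_add_distrib]
      map_smul' := fun r t => by
        simp only [pB, Finset.smul_sum, RingHom.id_apply, ← Complex.coe_smul, smul_smul]
        simp [mul_left_comm] }
  let lL : (Fin 4 → Fin 4 → ℂ) →ₗ[ℝ] M22 :=
    { toFun := pL
      map_add' := pL_add
      map_smul' := fun r t => by
        simp only [pL, Finset.smul_sum, RingHom.id_apply, ← Complex.coe_smul, smul_smul]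
        simp }
  let cA := LinearMap.toContinuousLinearMap lA
  let cB := LinearMap.toContinuousLinearMap lB
  let cL := LinearMap.toContinuousLinearMap lL
  let c1 := LinearMap.toContinuousLinearMap k1
  let c2 := LinearMap.toContinuousLinearMap k2
  let cM := cL - c1.comp cA - c2.comp cB
  have hM : ∀ c, cM c = pM c := fun c => rfl
  have d22 : HasStrictFDerivAt (NormedSpace.exp : M22 → M22) (1 : M22 →L[ℝ] M22) 0 :=
    hasStrictFDerivAt_exp_zero
  have d2 : HasStrictFDerivAt (NormedSpace.exp : M2 → M2) (1 : M2 →L[ℝ] M2) 0 :=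
    hasStrictFDerivAt_exp_zero
  have dm : HasStrictFDerivAt (fun c => NormedSpace.exp (cM c)) ((1 : M22 →L[ℝ] M22).comp cM) 0 :=
    HasStrictFDerivAt.comp 0 (by rw [map_zero]; exact d22) cM.hasStrictFDerivAt
  have da : HasStrictFDerivAt (fun c => c1 (NormedSpace.exp (cA c)))
      (c1.comp ((1 : M2 →L[ℝ] M2).comp cA)) 0 :=
    c1.hasStrictFDerivAt.comp 0
      (HasStrictFDerivAt.comp (0 : Fin 4 → Fin 4 → ℂ) (by rw [map_zero]; exact d2) cA.hasStrictFDerivAt)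
  have db : HasStrictFDerivAt (fun c => c2 (NormedSpace.exp (cB c)))
      (c2.comp ((1 : M2 →L[ℝ] M2).comp cB)) 0 :=
    c2.hasStrictFDerivAt.comp 0
      (HasStrictFDerivAt.comp (0 : Fin 4 → Fin 4 → ℂ) (by rw [map_zero]; exact d2) cB.hasStrictFDerivAt)
  have c1o : c1 1 = 1 := Matrix.one_kronecker_one
  have c2o : c2 1 = 1 := Matrix.one_kronecker_one
  have df : HasStrictFDerivAt (fun c => NormedSpace.exp (cM c) *
      (c1 (NormedSpace.exp (cA c)) * c2 (NormedSpace.exp (cB c)))) cL 0 := by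
    have := dm.mul' (da.mul' db)
    refine this.congr_fderiv ?_
    ext c : 1
    simp only [map_zero, NormedSpace.exp_zero, c1o, c2o, Pi.mul_apply, mul_one]
    change (1 : M22) * ((1 : M22) * c2 (cB c) + c1 (cA c) * (1 : M22)) +
      (cL c - c1 (cA c) - c2 (cB c)) * (1 : M22) = cL c
    rw [Matrix.one_mul, Matrix.one_mul, Matrix.mul_one, Matrix.mul_one]
    abel
  have hsurj : (cL : (Fin 4 → Fin 4 → ℂ) →L[ℝ] M22).range = ⊤ := by
    rw [LinearMap.range_eq_top]
    exact pL_surj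
  have hmap := df.map_nhds_eq_of_surj hsurj
  simp only [map_zero, NormedSpace.exp_zero, c1o, c2o, mul_one] at hmap
  -- injectivity of exp
  have d22' : HasStrictFDerivAt (NormedSpace.exp : M22 → M22)
      ((ContinuousLinearEquiv.refl ℝ M22 : M22 ≃L[ℝ] M22) : M22 →L[ℝ] M22) 0 := d22
  let Φ := d22'.toOpenPartialHomeomorph NormedSpace.exp
  have hS : Φ.source ∈ 𝓝 (0 : M22) := Φ.open_source.mem_nhds d22'.mem_toOpenPartialHomeomorph_source
  have hinj : Set.InjOn (NormedSpace.exp : M22 → M22) Φ.source := Φ.injOn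
  have hc0 : cM 0 = 0 := map_zero _
  have hctr : Continuous (fun M : M22 => M.trace) := continuous_id.matrix_trace
  have hcst : Continuous (fun M : M22 => -Mᴴ) := continuous_id.matrix_conjTranspose.neg
  have W1 : ∀ᶠ c in 𝓝 (0 : Fin 4 → Fin 4 → ℂ), cM c ∈ Φ.source :=
    cM.continuous.tendsto' 0 0 hc0 |>.eventually hS
  have W2 : ∀ᶠ c in 𝓝 (0 : Fin 4 → Fin 4 → ℂ), -(cM c)ᴴ ∈ Φ.source :=
    (hcst.comp cM.continuous).tendsto' 0 0 (by simp [hc0]) |>.eventually hS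
  have W3 : ∀ᶠ c in 𝓝 (0 : Fin 4 → Fin 4 → ℂ), (cM c).trace ∈ Metric.ball (0 : ℂ) 1 :=
    (hctr.comp cM.continuous).tendsto' 0 0 (by simp [hc0])
      |>.eventually (Metric.ball_mem_nhds _ one_pos)
  refine ⟨_, hmap ▸ Filter.image_mem_map (W1.and (W2.and W3)), ?_⟩
  rintro u ⟨c, ⟨w1, w2, w3⟩, rfl⟩ hu
  have sA := isSU_exp (pA_skew c) (pA_trace c)
  have sB := isSU_exp (pB_skew c) (pB_trace c)
  have hk : c1 (NormedSpace.exp (cA c)) * c2 (NormedSpace.exp (cB c)) =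
      NormedSpace.exp (pA c) ⊗ₖ NormedSpace.exp (pB c) := by
    change (NormedSpace.exp (pA c) ⊗ₖ (1 : M2)) * ((1 : M2) ⊗ₖ NormedSpace.exp (pB c)) = _
    rw [← Matrix.mul_kronecker_mul, Matrix.mul_one, Matrix.one_mul]
  dsimp only at hu ⊢
  rw [hk] at hu ⊢
  rw [hM] at *
  have sK := sA.kron sB
  have sE : IsSU (NormedSpace.exp (pM c)) := by
    have := hu.mul sK.star
    rwa [Matrix.mul_assoc, sK.1, Matrix.mul_one] at this
  have hsk : (pM c)ᴴ = - pM c := by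
    have h1 : NormedSpace.exp (-(pM c)ᴴ) = NormedSpace.exp (pM c) := by
      rw [Matrix.exp_neg, Matrix.exp_conjTranspose]
      exact Matrix.inv_eq_left_inv sE.1
    have h2 := hinj w2 w1 h1
    exact neg_eq_iff_eq_neg.mp h2
  have htr : (pM c).trace = 0 := by
    have h1 := sE.2
    rw [det_exp_skew hsk, Complex.exp_eq_one_iff] at h1
    obtain ⟨k, hk⟩ := h1
    rw [hk] at w3 ⊢
    have hk0 : k = 0 := by
      by_contra hne
      have h5 : (1 : ℝ) ≤ |(k : ℝ)| := by exact_mod_cast Int.one_le_abs hne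
      have h6 : |(k : ℝ)| * (2 * Real.pi) < 1 := by
        simpa [abs_of_pos Real.pi_pos] using w3
      nlinarith [Real.pi_gt_three]
    simp [hk0]
  obtain ⟨t, ht⟩ := pM_form c hsk htr
  exact ⟨t, _, _, sA, sB, by rw [ht]⟩

theorem slice_cover : ∃ s : ℕ → M22, ∀ u, IsSU u → ∃ (k : ℕ) (t : Fin 3 → Fin 3 → ℝ) (a b : M2),
    IsSU a ∧ IsSU b ∧ u = s k * NormedSpace.exp (pT t) * (a ⊗ₖ b) := by
  obtain ⟨N, hN, h⟩ := slice_nhds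
  have : SecondCountableTopology M22 :=
    inferInstanceAs (SecondCountableTopology (Fin 2 × Fin 2 → Fin 2 × Fin 2 → ℂ))
  obtain ⟨T, hT, hTc, hcov⟩ := TopologicalSpace.countable_cover_nhdsWithin
    (s := {u : M22 | IsSU u}) (f := fun v => {u | vᴴ * u ∈ N}) (by
      intro v hv
      refine mem_nhdsWithin_of_mem_nhds ?_
      have hc : Continuous (fun u : M22 => vᴴ * u) := continuous_const.mul continuous_id
      refine hc.continuousAt.preimage_mem_nhds ?_
      rw [IsSU.left hv]
      exact hN)
  have hne : T.Nonempty := by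
    have := hcov (show (1 : M22) ∈ {u : M22 | IsSU u} from IsSU.one)
    simp only [Set.mem_iUnion] at this
    obtain ⟨x, hx, _⟩ := this
    exact ⟨x, hx⟩
  obtain ⟨s, rfl⟩ := hTc.exists_eq_range hne
  refine ⟨s, fun u hu => ?_⟩
  have := hcov (show u ∈ {u : M22 | IsSU u} from hu)
  simp only [Set.mem_iUnion] at this
  obtain ⟨_, ⟨k, rfl⟩, hx⟩ := this
  have hk : IsSU (s k) := hT ⟨k, rfl⟩
  obtain ⟨t, a, b, ha, hb, e⟩ := h _ hx (hk.star.mul hu)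
  refine ⟨k, t, a, b, ha, hb, ?_⟩
  rw [Matrix.mul_assoc, ← e, ← Matrix.mul_assoc, hk.1, Matrix.one_mul]

end Slice


/-- reduced circuit -/
noncomputable def redC (s : ℕ → M22) {n R : ℕ} (A : Architecture n R) (k : Fin R → ℕ)
    (t : Fin R → Fin 3 → Fin 3 → ℝ) : NMatrix n :=
  (List.ofFn fun i => embP (A i).1 (s (k i) * NormedSpace.exp (pT (t i)))).reverse.prod

theorem circuit_form {n : ℕ} (s : ℕ → M22)
    (hs : ∀ u, IsSU u → ∃ (k : ℕ) (t : Fin 3 → Fin 3 → ℝ) (a b : M2),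
      IsSU a ∧ IsSU b ∧ u = s k * NormedSpace.exp (pT t) * (a ⊗ₖ b)) :
    ∀ (R : ℕ) (A : Architecture n R) (x : Fin R → SU4),
      ∃ (k : Fin R → ℕ) (t : Fin R → Fin 3 → Fin 3 → ℝ) (g : Fin n → M2),
        (∀ i, IsSU (g i)) ∧ contract A x = redC s A k t * locT g := by
  intro R
  induction R with
  | zero =>
    intro A x
    refine ⟨fun _ => 0, fun _ => 0, fun _ => 1, fun _ => IsSU.one, ?_⟩
    simp [contract, gateList, redC, locT_one]
  | succ R ih =>
    intro A x
    obtain ⟨k, t, g, hg, e⟩ := ih (fun i => A i.succ) (fun i => x i.succ)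
    have hp := (A 0).2
    set p := (A 0).1 with hpdef
    have hw := IsSU.of_SU4 (x 0)
    set w := ((x 0 : SU4) : Matrix (Fin 4) (Fin 4) ℂ).submatrix pairE pairE with hwdef
    obtain ⟨k0, t0, a, b, ha, hb, e0⟩ := hs _ (((hg p.1).kron (hg p.2)).mul hw)
    refine ⟨Fin.cons k0 k, Fin.cons t0 t, Function.update (Function.update g p.1 a) p.2 b, ?_, ?_⟩
    · intro i
      by_cases h2 : i = p.2
      · subst h2; simpa using hb
      by_cases h1 : i = p.1
      · subst h1; simpa [h2] using ha
      simpa [h1, h2] using hg i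
    · have l1 : contract A x = contract (fun i => A i.succ) (fun i => x i.succ) * embP p w := by
        simp [contract, gateList, List.ofFn_succ, embedGate_eq, ← hpdef, ← hwdef]
      have l2 : redC s A (Fin.cons k0 k) (Fin.cons t0 t) =
          redC s (fun i => A i.succ) k t * embP p (s k0 * NormedSpace.exp (pT t0)) := by
        simp [redC, List.ofFn_succ, ← hpdef]
      rw [l1, l2, e, Matrix.mul_assoc, Matrix.mul_assoc]
      congr 1
      refine loc_emb p hp _ _ _ _ ?_ ?_
      · intro i h1 h2; simp [h1, h2]
      · rw [e0]; simp [hp]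

theorem mul_entry_contDiff {E m : Type} [NormedAddCommGroup E] [NormedSpace ℝ E] [Fintype m]
    {f g : E → Matrix m m ℂ} (hf : ∀ i j, ContDiff ℝ 1 fun x => f x i j)
    (hg : ∀ i j, ContDiff ℝ 1 fun x => g x i j) (i j : m) :
    ContDiff ℝ 1 fun x => (f x * g x) i j := by
  simp only [Matrix.mul_apply]
  exact ContDiff.sum fun k _ => (hf i k).mul (hg k j)

theorem redC_contDiff (s : ℕ → M22) {n : ℕ} {E : Type} [NormedAddCommGroup E] [NormedSpace ℝ E] :
    ∀ (R : ℕ) (A : Architecture n R) (k : Fin R → ℕ) (T : E → Fin R → Fin 3 → Fin 3 → ℝ)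
      (_ : ContDiff ℝ 1 T) (a b : QubitBasis n),
      ContDiff ℝ 1 (fun x => redC s A k (T x) a b) := by
  intro R
  induction R with
  | zero =>
    intro A k T hT a b
    simp only [redC, List.ofFn_zero]
    exact contDiff_const
  | succ R ih =>
    intro A k T hT a b
    have l2 : ∀ x, redC s A k (T x) =
        redC s (fun i => A i.succ) (fun i => k i.succ) (fun i => T x i.succ) *
          embP (A 0).1 (s (k 0) * NormedSpace.exp (pT (T x 0))) := by
      intro x
      simp [redC, List.ofFn_succ]
    simp only [l2]
    have hTi : ∀ i, ContDiff ℝ 1 (fun x => T x i) := fun i => contDiff_pi.mp hT i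
    refine mul_entry_contDiff (fun c d => ih _ _ _ (contDiff_pi.mpr fun i => hTi _) c d) ?_ a b
    intro c d
    simp only [embP]
    split
    · refine mul_entry_contDiff (f := fun _ => s (k 0))
        (g := fun x => NormedSpace.exp (pT (T x 0))) (fun _ _ => contDiff_const) ?_ _ _
      intro i j
      exact (exp_entry_contDiff i j).comp (hTi 0)
    · exact contDiff_const

/-! ## Statement 3: upper bound on the accessible dimension -/

/-- **Upper bound on the accessible dimension.**  For every `n`-qubit architecture `A` with
`R` gates, the accessible dimension satisfies `d_A ≤ 9R + 3n`. -/
theorem accessible_dimension_upper_bound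
    (n R : ℕ) (hn : 2 ≤ n) (A : Architecture n R) :
    accessibleDim A ≤ ((9 * R + 3 * n : ℕ) : ℝ≥0∞) := by
  obtain ⟨s, hs⟩ := slice_cover
  let G : (Fin R → ℕ) → ((Fin R → Fin 3 → Fin 3 → ℝ) × (Fin n → Fin 3 → ℝ)) →
      EuclideanSpace ℂ (QubitBasis n × QubitBasis n) :=
    fun k y => toEuc (redC s A k y.1 * locT (fun i => su2P (y.2 i)))
  have hsub : toEuc '' Set.range (contract A) ⊆ ⋃ k, Set.range (G k) := by
    rintro _ ⟨_, ⟨x, rfl⟩, rfl⟩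
    obtain ⟨k, t, g, hg, e⟩ := circuit_form s hs R A x
    choose θ hθ using fun i => su2P_surj (hg i)
    refine Set.mem_iUnion.mpr ⟨k, (t, θ), ?_⟩
    simp only [G]
    rw [e]
    congr 3
    funext i
    exact (hθ i).symm
  refine (dimH_mono hsub).trans ?_
  rw [dimH_iUnion]
  refine iSup_le fun k => ?_
  have hG : ContDiff ℝ 1 (G k) := by
    refine contDiff_piLp' 2 fun q => ?_
    change ContDiff ℝ 1 fun y : (Fin R → Fin 3 → Fin 3 → ℝ) × (Fin n → Fin 3 → ℝ) =>
      (redC s A k y.1 * locT (fun i => su2P (y.2 i))) q.1 q.2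
    refine mul_entry_contDiff (redC_contDiff s R A k _ contDiff_fst) ?_ _ _
    intro a b
    simp only [locT]
    refine contDiff_prod fun i _ => ?_
    exact (su2P_contDiff (a i) (b i)).comp (contDiff_pi.mp contDiff_snd i)
  refine hG.dimH_range_le.trans ?_
  have : Module.finrank ℝ ((Fin R → Fin 3 → Fin 3 → ℝ) × (Fin n → Fin 3 → ℝ)) = 9 * R + 3 * n := by
    simp [Module.finrank_prod, Module.finrank_pi_fintype]
    ring
  rw [this]
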